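/- Let 0 < p < ∞, 0 < s < 2/p, 1/τ = s/2 + 1/p, and for ε ∈ (0,1] let f_ε = 1_{[0,ε]×[0,1]} be the characteristic function of the rectangle [0,ε]×[0,1] ⊆ ℝ². Then there is a constant c > 0 (depending only on s, p) such that |f_ε|_{B^{s,1}_τ} ≥ c · ε^{−s/2} · ‖f_ε‖_{L^p(ℝ²)} for all ε ∈ (0,1]. In particular, since ε^{−s/2} → ∞ as ε → 0, there is no constant c' with |f|_{B^{s,1}_τ} ≤ c' ‖f‖_{L^p(ℝ²)} valid for all such indicator functions. -/

import Mathlib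

open scoped Classical

open Set Metric MeasureTheory ENNReal

noncomputable section

/-- The Euclidean plane `ℝ²`. -/
abbrev Plane : Type := EuclideanSpace ℝ (Fin 2)

/-- `Q` is a compact regular convex set whose boundary is a polygon consisting of at most
`N₀` line segments, with eccentricity bounded by `c₀`. -/
def IsRegularConvexPolygon (N₀ : ℕ) (c₀ : ℝ) (Q : Set Plane) : Prop :=
  IsCompact Q ∧ Convex ℝ Q ∧ Q.Nonempty ∧
    (∃ (m : ℕ) (v w : Fin m → Plane), m ≤ N₀ ∧ frontier Q = ⋃ i, segment ℝ (v i) (w i)) ∧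
    (∃ (x₁ x₂ : Plane) (r₁ r₂ : ℝ), 0 < r₂ ∧
      closedBall x₂ r₂ ⊆ Q ∧ Q ⊆ closedBall x₁ r₁ ∧ r₁ ≤ c₀ * r₂)

/-- There is a triangle contained in `R` having the segment `[a,b]` as a side, whose two
angles adjacent to that side are equal to `β`. -/
def HasGoodTriangle (β : ℝ) (R : Set Plane) (a b : Plane) : Prop :=
  ∃ c : Plane, convexHull ℝ {a, b, c} ⊆ R ∧
    EuclideanGeometry.angle b a c = β ∧ EuclideanGeometry.angle a b c = β

/-- `R ⊆ ℝ²` is a ring with structural parameters `N₀`, `c₀`, `β`: the difference of two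
regular compact convex sets with polygonal boundaries, admitting no uncontrollably narrow
elongated subregions (each maximal edge of the boundary can be subdivided into at most two
segments, each carrying a good triangle with adjacent angles `β` inside `R`). -/
def IsRing (N₀ : ℕ) (c₀ β : ℝ) (R : Set Plane) : Prop :=
  (∃ Q₁ Q₂ : Set Plane,
      IsRegularConvexPolygon N₀ c₀ Q₁ ∧
      (Q₂ = ∅ ∨ (Q₂ ⊆ Q₁ ∧ IsRegularConvexPolygon N₀ c₀ Q₂)) ∧
      R = Q₁ \ interior Q₂) ∧
  (∃ (m : ℕ) (v w : Fin m → Plane),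
      frontier R = ⋃ i, segment ℝ (v i) (w i) ∧
      (∀ i, ∀ a b : Plane, segment ℝ (v i) (w i) ⊆ segment ℝ a b →
        segment ℝ a b ⊆ frontier R → segment ℝ a b = segment ℝ (v i) (w i)) ∧
      (∀ i, ∃ p ∈ segment ℝ (v i) (w i),
        HasGoodTriangle β R (v i) p ∧ HasGoodTriangle β R p (w i)))

/-- `Ω` is the union of `n` rings with pairwise disjoint interiors. -/
def IsRingDecomp (N₀ : ℕ) (c₀ β : ℝ) (n : ℕ) (Ω : Set Plane) : Prop :=
  ∃ R : Fin n → Set Plane,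
    (∀ j, IsRing N₀ c₀ β (R j)) ∧
    (∀ i j, i ≠ j → interior (R i) ∩ interior (R j) = ∅) ∧
    (⋃ j, R j) = Ω

/-- Membership in the nonlinear spline class `S(n,k)`: piecewise polynomials of total degree
`< k` over `n` rings with pairwise disjoint interiors whose union is `Ω` (or, when `Ω = ℝ²`,
whose union -- the support of the spline -- is itself a ring), having maximum smoothness
`W^{k-2}(Ω)` when `k ≥ 2` (no smoothness is required for piecewise constants, `k = 1`). -/
def IsSpline (N₀ : ℕ) (c₀ β : ℝ) (n k : ℕ) (Ω : Set Plane) (S : Plane → ℝ) : Prop :=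
  ∃ (R : Fin n → Set Plane) (P : Fin n → MvPolynomial (Fin 2) ℝ),
    (∀ j, IsRing N₀ c₀ β (R j)) ∧
    (∀ i j, i ≠ j → interior (R i) ∩ interior (R j) = ∅) ∧
    ((⋃ j, R j) = Ω ∨ (Ω = Set.univ ∧ IsRing N₀ c₀ β (⋃ j, R j))) ∧
    (∀ j, (P j).totalDegree < k) ∧
    (S = fun x => ∑ j, (R j).indicator (fun y => MvPolynomial.eval (fun i => y i) (P j)) x) ∧
    (2 ≤ k → ContDiffOn ℝ ((k - 2 : ℕ) : ℕ∞) S Ω)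

/-- The spline class `S(n,k,r)` with defect: smoothness `W^r(Ω)` instead of the maximal
smoothness `W^{k-2}(Ω)`. -/
def IsSplineDefect (N₀ : ℕ) (c₀ β : ℝ) (n k r : ℕ) (Ω : Set Plane) (S : Plane → ℝ) : Prop :=
  ∃ (R : Fin n → Set Plane) (P : Fin n → MvPolynomial (Fin 2) ℝ),
    (∀ j, IsRing N₀ c₀ β (R j)) ∧
    (∀ i j, i ≠ j → interior (R i) ∩ interior (R j) = ∅) ∧
    ((⋃ j, R j) = Ω ∨ (Ω = Set.univ ∧ IsRing N₀ c₀ β (⋃ j, R j))) ∧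
    (∀ j, (P j).totalDegree < k) ∧
    (S = fun x => ∑ j, (R j).indicator (fun y => MvPolynomial.eval (fun i => y i) (P j)) x) ∧
    ContDiffOn ℝ ((r : ℕ) : ℕ∞) S Ω

/-- The `L^p(Ω)` quasi-norm, `0 < p < ∞`. -/
def lpNormE (p : ℝ) (Ω : Set Plane) (f : Plane → ℝ) : ℝ≥0∞ :=
  eLpNorm f (ENNReal.ofReal p) (volume.restrict Ω)

/-- `k`-th finite difference `Δ_h^k f(x)`, set to `0` unless the segment `[x, x+kh] ⊆ Ω`. -/
def deltah (Ω : Set Plane) (k : ℕ) (h : Plane) (f : Plane → ℝ) (x : Plane) : ℝ :=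
  if segment ℝ x (x + (k : ℝ) • h) ⊆ Ω then
    ∑ ν ∈ Finset.range (k + 1), (-1 : ℝ) ^ (k + ν) * (k.choose ν : ℝ) * f (x + (ν : ℝ) • h)
  else 0

/-- Modulus of smoothness `ω_k(f,t)_τ = sup_{|h| ≤ t} ‖Δ_h^k f‖_{L^τ(Ω)}`. -/
def modulus (Ω : Set Plane) (k : ℕ) (τ : ℝ) (f : Plane → ℝ) (t : ℝ) : ℝ≥0∞ :=
  ⨆ (h : Plane) (_ : ‖h‖ ≤ t), lpNormE τ Ω (deltah Ω k h f)

/-- Besov seminorm `|f|_{B^{s,k}_τ} = (∫₀^∞ [t^{-s} ω_k(f,t)_τ]^τ dt/t)^{1/τ}`. -/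
def besovSeminorm (Ω : Set Plane) (k : ℕ) (s τ : ℝ) (f : Plane → ℝ) : ℝ≥0∞ :=
  (∫⁻ t in Set.Ioi (0 : ℝ),
      (ENNReal.ofReal (t ^ (-s)) * modulus Ω k τ f t) ^ τ / ENNReal.ofReal t) ^ (1 / τ)

/-- Error of best `L^p(Ω)`-approximation `S_n^k(f)_p` from the spline class `S(n,k)`. -/
def splineApprox (N₀ : ℕ) (c₀ β : ℝ) (n k : ℕ) (p : ℝ) (Ω : Set Plane) (f : Plane → ℝ) :
    ℝ≥0∞ :=
  ⨅ (S : Plane → ℝ) (_ : IsSpline N₀ c₀ β n k Ω S), lpNormE p Ω fun x => f x - S x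

/-- The K-functional `K(f,t; L^p(Ω), B^{s,k}_τ)`. -/
def kFunctional (Ω : Set Plane) (k : ℕ) (s τ p : ℝ) (f : Plane → ℝ) (t : ℝ) : ℝ≥0∞ :=
  ⨅ g : Plane → ℝ,
    lpNormE p Ω (fun x => f x - g x) + ENNReal.ofReal t * besovSeminorm Ω k s τ g

/-- BV seminorm: the total mass of the distributional gradient of `g` on `Ω`, defined by
duality against compactly supported `C¹` vector fields of norm at most one. -/
def bvSeminorm (Ω : Set Plane) (g : Plane → ℝ) : ℝ≥0∞ :=
  ⨆ (φ : Plane → Plane) (_ : ContDiff ℝ 1 φ ∧ HasCompactSupport φ ∧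
      tsupport φ ⊆ interior Ω ∧ ∀ x, ‖φ x‖ ≤ 1),
    ENNReal.ofReal (∫ x in Ω, g x * ∑ i, fderiv ℝ φ x (EuclideanSpace.single i 1) i)

/-- The K-functional `K(f,t; L²(Ω), BV(Ω))`. -/
def kFunctionalBV (Ω : Set Plane) (f : Plane → ℝ) (t : ℝ) : ℝ≥0∞ :=
  ⨅ g : Plane → ℝ,
    lpNormE 2 Ω (fun x => f x - g x) + ENNReal.ofReal t * bvSeminorm Ω g

/-- The characteristic function of the rectangle `[0,ε] × [0,1] ⊆ ℝ²`. -/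
def fEps (ε : ℝ) : Plane → ℝ :=
  Set.indicator {x : Plane | x 0 ∈ Set.Icc 0 ε ∧ x 1 ∈ Set.Icc 0 1} 1

lemma volume_rectangle (ε : ℝ) :
    volume {x : Plane | x 0 ∈ Set.Icc 0 ε ∧ x 1 ∈ Set.Icc 0 1} = ENNReal.ofReal ε := by
  have h := (EuclideanSpace.volume_preserving_symm_measurableEquiv_toLp
    (Fin 2)).measure_preimage_equiv (Set.univ.pi ![Set.Icc (0 : ℝ) ε, Set.Icc 0 1])
  rw [volume_pi_pi] at h
  simp only [Fin.prod_univ_two, Matrix.cons_val_zero, Matrix.cons_val_one, Real.volume_Icc,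
    sub_zero, ENNReal.ofReal_one, mul_one] at h
  rw [← h]
  congr 1
  ext x
  simp [Set.mem_pi, Fin.forall_fin_two]

lemma measurableSet_rectangle (ε : ℝ) :
    MeasurableSet {x : Plane | x 0 ∈ Set.Icc 0 ε ∧ x 1 ∈ Set.Icc 0 1} := by
  apply MeasurableSet.inter
  · exact measurableSet_Icc.preimage (by fun_prop : Measurable fun x : Plane => x 0)
  · exact measurableSet_Icc.preimage (by fun_prop : Measurable fun x : Plane => x 1)

lemma lpNormE_fEps {q : ℝ} (hq : 0 < q) {ε : ℝ} (hε : 0 < ε) :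
    lpNormE q Set.univ (fEps ε) = ENNReal.ofReal (ε ^ (1 / q)) := by
  have h := eLpNorm_indicator_const (μ := (volume : Measure Plane)) (c := (1 : ℝ))
    (measurableSet_rectangle ε) (p := ENNReal.ofReal q) (by simpa using hq) ENNReal.ofReal_ne_top
  rw [volume_rectangle, ENNReal.toReal_ofReal hq.le, enorm_one, one_mul,
    ENNReal.ofReal_rpow_of_pos hε] at h
  rw [lpNormE, Measure.restrict_univ, ← h]
  rfl

/-- A horizontal shift by more than `ε` moves the rectangle off itself. -/
lemma lpNormE_fEps_le_modulus (q : ℝ) {ε t : ℝ} (hε : 0 < ε) (ht : ε < t) :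
    lpNormE q Set.univ (fEps ε) ≤ modulus Set.univ 1 q (fEps ε) t := by
  refine le_iSup₂_of_le (EuclideanSpace.single 0 t) (by simp [abs_of_pos (hε.trans ht)]) ?_
  refine eLpNorm_mono fun x => ?_
  by_cases hx : x ∈ {x : Plane | x 0 ∈ Set.Icc 0 ε ∧ x 1 ∈ Set.Icc 0 1}
  · have hx' : x + EuclideanSpace.single 0 t ∉
        {x : Plane | x 0 ∈ Set.Icc 0 ε ∧ x 1 ∈ Set.Icc 0 1} := by
      rintro ⟨⟨-, h⟩, -⟩
      have h0 := hx.1.1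
      simp at h
      linarith
    have h1 : fEps ε x = 1 := Set.indicator_of_mem hx _
    have h2 : fEps ε (x + EuclideanSpace.single 0 t) = 0 := Set.indicator_of_notMem hx' _
    simp [deltah, Finset.sum_range_succ, h1, h2]
  · have h1 : fEps ε x = 0 := Set.indicator_of_notMem hx _
    simp [h1]

lemma besovSeminorm_fEps_ge {p s τ : ℝ} (hs : 0 < s) (hτ0 : 0 < τ)
    (hτ : 1 / τ = s / 2 + 1 / p) {ε : ℝ} (hε : 0 < ε) :
    ENNReal.ofReal (2 ^ (-s - 1 / τ) * ε ^ (-(s / 2)) * ε ^ (1 / p)) ≤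
      besovSeminorm Set.univ 1 s τ (fEps ε) := by
  have hbound : ∀ t ∈ Set.Ioc ε (2 * ε),
      ENNReal.ofReal (((2 * ε) ^ (-s) * ε ^ (1 / τ)) ^ τ / (2 * ε)) ≤
        (ENNReal.ofReal (t ^ (-s)) * modulus Set.univ 1 τ (fEps ε) t) ^ τ /
          ENNReal.ofReal t := by
    rintro t ⟨ht1, ht2⟩
    have ht0 : 0 < t := hε.trans ht1
    have hm := lpNormE_fEps_le_modulus τ hε ht1
    rw [lpNormE_fEps hτ0 hε] at hm
    rw [ENNReal.ofReal_div_of_pos (by positivity), ← ENNReal.ofReal_rpow_of_pos (by positivity),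
      ENNReal.ofReal_mul (by positivity)]
    gcongr ?_ / ?_
    · gcongr ?_ ^ τ
      refine mul_le_mul' (ENNReal.ofReal_le_ofReal ?_) hm
      exact Real.rpow_le_rpow_of_nonpos ht0 ht2 (by linarith)
    · exact ENNReal.ofReal_le_ofReal ht2
  have hint : ENNReal.ofReal (((2 * ε) ^ (-s) * ε ^ (1 / τ)) ^ τ / 2) ≤
      ∫⁻ t in Set.Ioi (0 : ℝ),
        (ENNReal.ofReal (t ^ (-s)) * modulus Set.univ 1 τ (fEps ε) t) ^ τ /
          ENNReal.ofReal t := by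
    calc _ = ∫⁻ _ in Set.Ioc ε (2 * ε),
          ENNReal.ofReal (((2 * ε) ^ (-s) * ε ^ (1 / τ)) ^ τ / (2 * ε)) := by
          rw [setLIntegral_const, Real.volume_Ioc, ← ENNReal.ofReal_mul (by positivity)]
          congr 1
          field_simp
          ring
      _ ≤ _ := setLIntegral_mono' measurableSet_Ioc hbound
      _ ≤ _ := lintegral_mono_set fun t ht => hε.trans ht.1
  refine le_trans (le_of_eq ?_) (ENNReal.rpow_le_rpow hint (by positivity : 0 ≤ 1 / τ))
  rw [ENNReal.ofReal_rpow_of_pos (by positivity)]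
  congr 1
  rw [Real.div_rpow (by positivity) (by positivity), ← Real.rpow_mul (by positivity),
    mul_one_div_cancel hτ0.ne', Real.rpow_one, Real.mul_rpow (by positivity) hε.le,
    Real.rpow_sub (by positivity), mul_assoc, ← Real.rpow_add hε, mul_assoc, ← Real.rpow_add hε,
    show -(s / 2) + 1 / p = -s + 1 / τ by rw [hτ]; ring]
  ring

/-- **The Besov seminorm of the characteristic function of the thin rectangle `[0,ε]×[0,1]`
blows up like `ε^{-s/2}` relative to its `L^p` norm; hence no uniform Bernstein inequality
`|f|_{B^{s,1}_τ} ≤ c'·‖f‖_{L^p}` can hold for such indicators.** -/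
theorem elongated_indicator_besov_blowup (p s τ : ℝ) (hp : 0 < p) (hs : 0 < s)
    (hs2 : s < 2 / p) (hτ : 1 / τ = s / 2 + 1 / p) :
    (∃ c : ℝ, 0 < c ∧ ∀ ε : ℝ, 0 < ε → ε ≤ 1 →
      ENNReal.ofReal (c * ε ^ (-(s / 2))) * lpNormE p Set.univ (fEps ε) ≤
        besovSeminorm Set.univ 1 s τ (fEps ε)) ∧
    ¬ ∃ c' : ℝ, ∀ ε : ℝ, 0 < ε → ε ≤ 1 →
        besovSeminorm Set.univ 1 s τ (fEps ε) ≤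
          ENNReal.ofReal c' * lpNormE p Set.univ (fEps ε) := by
  have hτ0 : 0 < τ := by
    rw [← one_div_pos, hτ]
    positivity
  have hc : (0 : ℝ) < 2 ^ (-s - 1 / τ) := by positivity
  have key : ∀ ε : ℝ, 0 < ε →
      ENNReal.ofReal (2 ^ (-s - 1 / τ) * ε ^ (-(s / 2))) * lpNormE p Set.univ (fEps ε) ≤
        besovSeminorm Set.univ 1 s τ (fEps ε) := by
    intro ε hε
    rw [lpNormE_fEps hp hε, ← ENNReal.ofReal_mul (by positivity)]
    exact besovSeminorm_fEps_ge hs hτ0 hτ hε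
  refine ⟨⟨_, hc, fun ε hε _ => key ε hε⟩, ?_⟩
  rintro ⟨c', h⟩
  generalize (2 : ℝ) ^ (-s - 1 / τ) = c at hc key
  have hM : 1 ≤ |c'| / c + 1 := le_add_of_nonneg_left (by positivity)
  have hM0 : 0 < |c'| / c + 1 := one_pos.trans_le hM
  have hε : 0 < (|c'| / c + 1) ^ (-(2 / s)) := Real.rpow_pos_of_pos hM0 _
  have hε1 : (|c'| / c + 1) ^ (-(2 / s)) ≤ 1 :=
    Real.rpow_le_one_of_one_le_of_nonpos hM (neg_nonpos.2 (by positivity))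
  have hle := (key _ hε).trans (h _ hε hε1)
  rw [lpNormE_fEps hp hε, ENNReal.mul_le_mul_iff_left
    (by simpa using Real.rpow_pos_of_pos hε _) ENNReal.ofReal_ne_top, ← Real.rpow_mul hM0.le,
    show -(2 / s) * -(s / 2) = 1 by field_simp, Real.rpow_one, mul_add,
    mul_div_cancel₀ _ hc.ne', mul_one] at hle
  have hpos : 0 < |c'| + c := by positivity
  rcases ENNReal.ofReal_le_ofReal_iff'.1 hle with h1 | h1
  · linarith [le_abs_self c']
  · linarith

end
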